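/- Let H_l ∈ Λ_{2n} be a fermionic spherical harmonic of degree l, and let k, l be integers with l ≤ n and k ≤ n − l. Then F^±_{0|2n}(x`^{2k} · H_l) = (±i)^l · 2^{2k+l−n} · (k!/(n−k−l)!) · y`^{2n−2k−2l} · H_l(y), where x`^{2k} = (x`²)^k with x`² = Σ_{j=1}^n x`_{2j−1} x`_{2j}, similarly for y`, and H_l(y) is H_l written in the y` variables. -/

import Mathlib

open scoped BigOperators
open Finset MeasureTheory

noncomputable section

/-- The Grassmann algebra on `N` anticommuting generators with coefficients in a
commutative ring `R`, represented by its coefficients with respect to the basis of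
increasingly-ordered monomials, indexed by subsets of the generators. -/
abbrev Gr (R : Type) (N : ℕ) : Type := Finset (Fin N) → R

namespace Gr

variable {R : Type} [CommRing R] {N : ℕ}

/-- The sign produced when reordering the concatenation of the ordered monomials indexed
by `A` and `B` into the ordered monomial indexed by `A ∪ B`. -/
def msign (A B : Finset (Fin N)) : R :=
  (-1 : R) ^ (((A ×ˢ B).filter fun p => p.2 < p.1).card)

/-- Multiplication of the Grassmann algebra. -/
def mul (f g : Gr R N) : Gr R N :=
  fun s => ∑ A ∈ s.powerset, msign A (s \ A) * f A * g (s \ A)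

/-- The unit of the Grassmann algebra. -/
def one : Gr R N := fun s => if s = (∅ : Finset (Fin N)) then 1 else 0

/-- The `j`-th generator of the Grassmann algebra. -/
def gen (j : Fin N) : Gr R N := fun s => if s = {j} then 1 else 0

/-- Powers in the Grassmann algebra. -/
def pow (f : Gr R N) : ℕ → Gr R N
  | 0 => one
  | k + 1 => mul (pow f k) f

/-- The left partial derivative `∂_j`, i.e. the odd derivation with `∂_j(x_k) = δ_{jk}`. -/
def pderiv (j : Fin N) (f : Gr R N) : Gr R N :=
  fun s => if j ∈ s then 0
    else (-1 : R) ^ ((s.filter fun i => i < j).card) * f (insert j s)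

/-- The exponential of a Grassmann algebra element with nilpotent (zero-constant-term)
argument: the series terminates, and all terms beyond degree `N` vanish. -/
def gexp (f : Gr ℂ N) : Gr ℂ N :=
  ∑ k ∈ Finset.range (N + 1), ((k.factorial : ℂ))⁻¹ • pow f k

/-- Iterated left partial derivatives: the first element of the list acts first. -/
def derivList (l : List (Fin N)) (f : Gr R N) : Gr R N :=
  l.foldl (fun g j => pderiv j g) f

/-- Complex conjugation of the coefficients. -/
def gconj (f : Gr ℂ N) : Gr ℂ N := fun s => (starRingEnd ℂ) (f s)

end Gr

/-- The Lean index of the paper's generator `x`_{2j-1}` (j = 1,…,n). -/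
def lo (n : ℕ) (j : Fin n) : Fin (2 * n) := ⟨2 * (j : ℕ), by have := j.isLt; omega⟩

/-- The Lean index of the paper's generator `x`_{2j}` (j = 1,…,n). -/
def hi (n : ℕ) (j : Fin n) : Fin (2 * n) := ⟨2 * (j : ℕ) + 1, by have := j.isLt; omega⟩

/-- `x`² = Σ_{j=1}^n x`_{2j-1} x`_{2j}`. -/
def xsq (n : ℕ) : Gr ℂ (2 * n) := ∑ j : Fin n, Gr.mul (Gr.gen (lo n j)) (Gr.gen (hi n j))

/-- The fermionic Laplace operator `Δ_f = 4 Σ_{j=1}^n ∂_{x`_{2j-1}} ∂_{x`_{2j}}`. -/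
def lapF (n : ℕ) (f : Gr ℂ (2 * n)) : Gr ℂ (2 * n) :=
  (4 : ℂ) • ∑ j : Fin n, Gr.pderiv (lo n j) (Gr.pderiv (hi n j) f)

/-- The Berezin integral `∫_B = π^{-n} ∂_{x`_{2n}} ⋯ ∂_{x`_1}`. -/
def berezin (n : ℕ) (f : Gr ℂ (2 * n)) : ℂ :=
  ((Real.pi : ℂ) ^ n)⁻¹ * Gr.derivList (List.finRange (2 * n)) f ∅

/-- The fermionic Gaussian `exp(x`²/2) = Σ_{j=0}^n (x`²)^j/(2^j j!)`. -/
def fermGauss (n : ℕ) : Gr ℂ (2 * n) :=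
  ∑ j ∈ Finset.range (n + 1), (((2 : ℂ) ^ j * j.factorial)⁻¹) • Gr.pow (xsq n) j

/-- Embedding of the `x` generators into the Grassmann algebra on the `4n` generators
`x`_1, …, x`_{2n}, y`_1, …, y`_{2n}` (the `x` generators come first). -/
def xi (n : ℕ) (t : Fin (2 * n)) : Fin (2 * n + 2 * n) := Fin.castAdd (2 * n) t

/-- Embedding of the `y` generators into the Grassmann algebra on the `4n` generators. -/
def yi (n : ℕ) (t : Fin (2 * n)) : Fin (2 * n + 2 * n) := Fin.natAdd (2 * n) t

/-- The algebra embedding `Λ_{2n} → Λ_{4n}` sending the generators to the `x` generators. -/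
def embX (n : ℕ) (f : Gr ℂ (2 * n)) : Gr ℂ (2 * n + 2 * n) :=
  fun s => ∑ A : Finset (Fin (2 * n)), if s = A.image (xi n) then f A else 0

/-- The Berezin integral with respect to the `x` variables,
`π^{-n} ∂_{x`_{2n}} ⋯ ∂_{x`_1}`, inside the mixed algebra `Λ_{4n}`. -/
def berezinX (n : ℕ) (F : Gr ℂ (2 * n + 2 * n)) : Gr ℂ (2 * n + 2 * n) :=
  ((Real.pi : ℂ) ^ n)⁻¹ • Gr.derivList ((List.finRange (2 * n)).map (xi n)) F

/-- The fermionic Fourier kernel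
`K^σ(x, y) = exp(-σ (i/2) Σ_{j=1}^n (x`_{2j-1} y`_{2j} - x`_{2j} y`_{2j-1}))`
(for the plus sign `σ = 1`, for the minus sign `σ = -1`). -/
def fermK (n : ℕ) (σ : ℂ) : Gr ℂ (2 * n + 2 * n) :=
  Gr.gexp ((-σ * (Complex.I / 2)) • ∑ j : Fin n,
    (Gr.mul (Gr.gen (xi n (lo n j))) (Gr.gen (yi n (hi n j))) -
     Gr.mul (Gr.gen (xi n (hi n j))) (Gr.gen (yi n (lo n j)))))

/-- The fermionic Fourier transform
`F^σ_{0|2n}(g)(y) = (2π)^n ∫_{B,x} K^σ(x,y) g(x)`, an element of the Grassmann algebra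
in the `y` variables, identified with `Λ_{2n}`. -/
def fermFT (n : ℕ) (σ : ℂ) (g : Gr ℂ (2 * n)) : Gr ℂ (2 * n) :=
  fun s => (((2 * Real.pi : ℝ) : ℂ) ^ n) *
    berezinX n (Gr.mul (fermK n σ) (embX n g)) (s.image (yi n))


end

namespace Gr

variable {R : Type} [CommRing R] {N : ℕ}

/-- The increasingly ordered monomial indexed by `A`. -/
def mono (A : Finset (Fin N)) : Gr R N := fun s => if s = A then 1 else 0

lemma msign_eq_prod (A B : Finset (Fin N)) :
    (msign A B : R) = ∏ a ∈ A, ∏ b ∈ B, if b < a then -1 else 1 := by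
  rw [← Finset.prod_product', msign, Finset.prod_ite]
  simp

lemma sum_mul_left {ι : Type} (s : Finset ι) (f : ι → Gr R N) (g : Gr R N) :
    mul (∑ i ∈ s, f i) g = ∑ i ∈ s, mul (f i) g := by
  ext u
  simp only [mul, Finset.sum_apply, Finset.mul_sum, Finset.sum_mul]
  rw [Finset.sum_comm]

lemma mul_sum_right {ι : Type} (s : Finset ι) (f : Gr R N) (g : ι → Gr R N) :
    mul f (∑ i ∈ s, g i) = ∑ i ∈ s, mul f (g i) := by
  ext u
  simp only [mul, Finset.sum_apply, Finset.mul_sum]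
  rw [Finset.sum_comm]

lemma smul_mul_left (c : R) (f g : Gr R N) : mul (c • f) g = c • mul f g := by
  ext u
  simp only [mul, Pi.smul_apply, smul_eq_mul, Finset.mul_sum]
  exact Finset.sum_congr rfl fun _ _ => by ring

lemma mul_smul_right (c : R) (f g : Gr R N) : mul f (c • g) = c • mul f g := by
  ext u
  simp only [mul, Pi.smul_apply, smul_eq_mul, Finset.mul_sum]
  exact Finset.sum_congr rfl fun _ _ => by ring

lemma mono_mul_apply (A : Finset (Fin N)) (g : Gr R N) (s : Finset (Fin N)) :
    mul (mono A) g s = if A ⊆ s then msign A (s \ A) * g (s \ A) else 0 := by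
  simp [mul, mono]

lemma mono_mul_mono (A B : Finset (Fin N)) :
    mul (mono A : Gr R N) (mono B) =
      if Disjoint A B then (msign A B : R) • mono (A ∪ B) else 0 := by
  ext s
  rw [mono_mul_apply]
  by_cases hd : Disjoint A B
  · by_cases hs : s = A ∪ B
    · subst hs
      simp [hd, Finset.union_sdiff_cancel_left hd, mono]
    · have : ¬ (A ⊆ s ∧ s \ A = B) := by
        rintro ⟨h1, rfl⟩
        exact hs (Finset.union_sdiff_of_subset h1).symm
      by_cases h1 : A ⊆ s
      · have h2 : s \ A ≠ B := fun h => this ⟨h1, h⟩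
        simp [hd, mono, hs, h2]
      · simp [hd, mono, hs, h1]
  · have : ∀ h : A ⊆ s, s \ A ≠ B := by
      rintro - rfl
      exact hd Finset.disjoint_sdiff
    by_cases h1 : A ⊆ s
    · simp [hd, mono, this h1]
    · simp [hd, h1]

end Gr

lemma sum_powersetCard_sum_insert {ι M : Type} [Fintype ι] [DecidableEq ι] [AddCommMonoid M]
    (G : Finset ι → M) (k : ℕ) :
    ∑ C ∈ powersetCard k univ, ∑ a ∈ Cᶜ, G (insert a C) =
      (k + 1) • ∑ C ∈ powersetCard (k + 1) univ, G C := by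
  have h : ∀ C ∈ powersetCard (k + 1) (univ : Finset ι), (k + 1) • G C = ∑ _a ∈ C, G C := by
    intro C hC
    rw [Finset.sum_const, (Finset.mem_powersetCard.1 hC).2]
  rw [Finset.smul_sum, Finset.sum_congr rfl h, Finset.sum_sigma', Finset.sum_sigma']
  refine Finset.sum_nbij' (fun p => ⟨insert p.2 p.1, p.2⟩) (fun p => ⟨p.1.erase p.2, p.2⟩)
    ?_ ?_ ?_ ?_ ?_
  · rintro ⟨C, a⟩ h
    simp only [mem_sigma, mem_powersetCard, subset_univ, true_and, mem_compl] at h ⊢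
    exact ⟨by rw [card_insert_of_notMem h.2, h.1], mem_insert_self _ _⟩
  · rintro ⟨C, a⟩ h
    simp only [mem_sigma, mem_powersetCard, subset_univ, true_and, mem_compl] at h ⊢
    exact ⟨by rw [card_erase_of_mem h.2, h.1]; rfl, notMem_erase _ _⟩
  · rintro ⟨C, a⟩ h
    simp only [mem_sigma, mem_compl] at h
    simp [erase_insert h.2]
  · rintro ⟨C, a⟩ h
    simp only [mem_sigma] at h
    simp [insert_erase h.2]
  · intros; rfl

namespace Gr

variable {R : Type} [CommRing R] {N : ℕ}

lemma pow_sum_mono {ι : Type} [Fintype ι] [DecidableEq ι] (M : ι → Finset (Fin N))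
    (hM : ∀ a b, a ≠ b → Disjoint (M a) (M b)) (hne : ∀ a, (M a).Nonempty)
    (c : ι → R) (ε : Finset ι → R) (h0 : ε ∅ = 1)
    (hε : ∀ D a, a ∉ D → ε (insert a D) = ε D * msign (D.biUnion M) (M a)) (k : ℕ) :
    pow (∑ a, c a • (mono (M a) : Gr R N)) k =
      (k.factorial : R) •
        ∑ C ∈ powersetCard k univ, (ε C * ∏ a ∈ C, c a) • mono (C.biUnion M) := by
  induction k with
  | zero => simp [pow, h0]; rfl
  | succ k ih =>
    rw [pow, ih, smul_mul_left, sum_mul_left]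
    have key : ∀ C : Finset ι,
        mul ((ε C * ∏ a ∈ C, c a) • (mono (C.biUnion M) : Gr R N)) (∑ a, c a • mono (M a)) =
          ∑ a ∈ Cᶜ, (ε (insert a C) * ∏ b ∈ insert a C, c b) •
            mono ((insert a C).biUnion M) := by
      intro C
      rw [mul_sum_right, ← Finset.sum_subset (Finset.subset_univ Cᶜ)]
      · refine Finset.sum_congr rfl fun a ha => ?_
        rw [mem_compl] at ha
        have hd : Disjoint (C.biUnion M) (M a) := by
          rw [Finset.disjoint_biUnion_left]
          exact fun b hb => hM b a fun h => ha (h ▸ hb)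
        rw [smul_mul_left, mul_smul_right, mono_mul_mono, if_pos hd, hε C a ha,
          prod_insert ha, biUnion_insert, union_comm, smul_smul, smul_smul]
        congr 1
        ring
      · intro a _ ha
        have hd : ¬ Disjoint (C.biUnion M) (M a) := by
          rw [mem_compl, not_not] at ha
          intro h
          obtain ⟨x, hx⟩ := hne a
          exact Finset.disjoint_left.1 h (mem_biUnion.2 ⟨a, ha, hx⟩) hx
        rw [smul_mul_left, mul_smul_right, mono_mul_mono, if_neg hd, smul_zero, smul_zero]
    simp_rw [key]
    rw [sum_powersetCard_sum_insert
      (fun C => (ε C * ∏ b ∈ C, c b) • (mono (C.biUnion M) : Gr R N)) k,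
      ← Nat.cast_smul_eq_nsmul R, smul_smul, Nat.factorial_succ]
    congr 1
    push_cast
    ring

end Gr

section Pairs

variable {n : ℕ}

lemma exists_eq_lo_or_eq_hi (t : Fin (2 * n)) : ∃ j, t = lo n j ∨ t = hi n j := by
  have := t.isLt
  refine ⟨⟨t / 2, by omega⟩, ?_⟩
  simp only [lo, hi, Fin.ext_iff]
  omega

@[simp] lemma lo_inj {i j : Fin n} : lo n i = lo n j ↔ i = j := by
  simp only [lo, Fin.ext_iff]; omega

@[simp] lemma hi_inj {i j : Fin n} : hi n i = hi n j ↔ i = j := by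
  simp only [hi, Fin.ext_iff]; omega

@[simp] lemma lo_ne_hi (i j : Fin n) : lo n i ≠ hi n j := by
  simp only [lo, hi, ne_eq, Fin.ext_iff]; omega

@[simp] lemma hi_ne_lo (i j : Fin n) : hi n i ≠ lo n j := (lo_ne_hi j i).symm

lemma lo_lt_hi (j : Fin n) : lo n j < hi n j := by
  simp only [lo, hi, Fin.lt_def]; omega

lemma prod_pairs {M : Type} [CommMonoid M] (f : Fin (2 * n) → M) :
    ∏ t, f t = ∏ j, f (lo n j) * f (hi n j) := by
  have h : (univ : Finset (Fin (2 * n))) = univ.image (lo n) ∪ univ.image (hi n) := by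
    ext t
    obtain ⟨j, rfl | rfl⟩ := exists_eq_lo_or_eq_hi t <;> simp
  rw [h, prod_union, prod_image, prod_image, prod_mul_distrib]
  · intro a _ b _; exact hi_inj.1
  · intro a _ b _; exact lo_inj.1
  · rw [Finset.disjoint_left]
    simp

lemma sum_pairs {M : Type} [AddCommMonoid M] (f : Fin (2 * n) → M) :
    ∑ t, f t = ∑ j, (f (lo n j) + f (hi n j)) :=
  prod_pairs (M := Multiplicative M) f

/-- The pair of indices `{2j-1, 2j}`. -/
def pair (n : ℕ) (j : Fin n) : Finset (Fin (2 * n)) := {lo n j, hi n j}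

@[simp] lemma lo_mem_biUnion_pair {C : Finset (Fin n)} {j : Fin n} :
    lo n j ∈ C.biUnion (pair n) ↔ j ∈ C := by
  simp [pair]

@[simp] lemma hi_mem_biUnion_pair {C : Finset (Fin n)} {j : Fin n} :
    hi n j ∈ C.biUnion (pair n) ↔ j ∈ C := by
  simp [pair]

lemma pairs_ext {s t : Finset (Fin (2 * n))}
    (h : ∀ j, (lo n j ∈ s ↔ lo n j ∈ t) ∧ (hi n j ∈ s ↔ hi n j ∈ t)) : s = t := by
  ext x
  obtain ⟨j, rfl | rfl⟩ := exists_eq_lo_or_eq_hi x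
  exacts [(h j).1, (h j).2]

lemma pair_disjoint {i j : Fin n} (h : i ≠ j) : Disjoint (pair n i) (pair n j) := by
  simp [pair, h.symm]

/-- The involution exchanging the two elements of every pair. -/
def swp (n : ℕ) (t : Fin (2 * n)) : Fin (2 * n) :=
  if h : (t : ℕ) % 2 = 0 then ⟨t + 1, by have := t.isLt; omega⟩ else ⟨t - 1, by omega⟩

@[simp] lemma swp_lo (j : Fin n) : swp n (lo n j) = hi n j := by
  simp [swp, lo, hi]

@[simp] lemma swp_hi (j : Fin n) : swp n (hi n j) = lo n j := by
  simp [swp, lo, hi, Nat.add_mod]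

@[simp] lemma swp_swp (t : Fin (2 * n)) : swp n (swp n t) = t := by
  obtain ⟨j, rfl | rfl⟩ := exists_eq_lo_or_eq_hi t <;> simp

lemma swp_injective : Function.Injective (swp n) :=
  Function.LeftInverse.injective swp_swp

lemma mem_image_swp {s : Finset (Fin (2 * n))} {t : Fin (2 * n)} :
    t ∈ s.image (swp n) ↔ swp n t ∈ s := by
  rw [mem_image]
  constructor
  · rintro ⟨a, ha, rfl⟩; simpa
  · exact fun h => ⟨_, h, swp_swp t⟩

lemma msign_pair {R : Type} [CommRing R] (j : Fin n) {B : Finset (Fin (2 * n))}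
    (h : Disjoint (pair n j) B) : (Gr.msign (pair n j) B : R) = 1 := by
  rw [Gr.msign_eq_prod, pair, prod_pair (lo_ne_hi j j), ← prod_mul_distrib]
  refine prod_eq_one fun b hb => ?_
  have h1 : b ≠ lo n j := by
    rintro rfl; exact Finset.disjoint_left.1 h (by simp [pair]) hb
  have h2 : b < lo n j ↔ b < hi n j := by
    simp only [lo, hi, ne_eq, Fin.ext_iff, Fin.lt_def] at h1 ⊢
    omega
  by_cases h3 : b < hi n j <;> simp [h2, h3]

lemma msign_biUnion_pair {R : Type} [CommRing R] (C : Finset (Fin n)) {B : Finset (Fin (2 * n))}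
    (h : Disjoint (C.biUnion (pair n)) B) : (Gr.msign (C.biUnion (pair n)) B : R) = 1 := by
  rw [Gr.msign_eq_prod, prod_biUnion fun i _ j _ hij => pair_disjoint hij]
  refine prod_eq_one fun j hj => ?_
  rw [← Gr.msign_eq_prod]
  exact msign_pair j (h.mono_left (subset_biUnion_of_mem _ hj))

lemma xsq_eq_sum_mono : xsq n = ∑ j : Fin n, (1 : ℂ) • Gr.mono (pair n j) := by
  refine Finset.sum_congr rfl fun j _ => ?_
  change Gr.mul (Gr.mono {lo n j}) (Gr.mono {hi n j}) = _
  rw [Gr.mono_mul_mono, if_pos (by simp), Gr.msign_eq_prod]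
  simp [(lo_lt_hi j).not_gt, pair]

lemma pow_xsq (k : ℕ) :
    Gr.pow (xsq n) k =
      (k.factorial : ℂ) • ∑ C ∈ powersetCard k univ, Gr.mono (C.biUnion (pair n)) := by
  rw [xsq_eq_sum_mono, Gr.pow_sum_mono (pair n) (fun _ _ => pair_disjoint)
    (fun j => ⟨lo n j, by simp [pair]⟩) _ (fun _ => 1) rfl]
  · simp
  · intro D a ha
    rw [one_mul, msign_biUnion_pair]
    rw [Finset.disjoint_biUnion_left]
    exact fun b hb => pair_disjoint fun h => ha (h ▸ hb)

lemma pow_xsq_mul_apply (k : ℕ) (f : Gr ℂ (2 * n)) (s : Finset (Fin (2 * n))) :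
    Gr.mul (Gr.pow (xsq n) k) f s =
      k.factorial * ∑ C ∈ powersetCard k univ,
        if C.biUnion (pair n) ⊆ s then f (s \ C.biUnion (pair n)) else 0 := by
  rw [pow_xsq, Gr.smul_mul_left, Gr.sum_mul_left]
  simp only [Pi.smul_apply, smul_eq_mul, Finset.sum_apply, Gr.mono_mul_apply,
    msign_biUnion_pair _ disjoint_sdiff, one_mul]

lemma lapF_apply (f : Gr ℂ (2 * n)) (s : Finset (Fin (2 * n))) :
    lapF n f s = -4 * ∑ j : Fin n,
      if lo n j ∉ s ∧ hi n j ∉ s then f (s ∪ pair n j) else 0 := by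
  simp only [lapF, Pi.smul_apply, Finset.sum_apply, smul_eq_mul, Finset.mul_sum]
  refine Finset.sum_congr rfl fun j _ => ?_
  by_cases h1 : lo n j ∈ s
  · simp [Gr.pderiv, h1]
  by_cases h2 : hi n j ∈ s
  · simp [Gr.pderiv, h2]
  have hc : ((insert (lo n j) s).filter fun i => i < hi n j) =
      insert (lo n j) (s.filter fun i => i < lo n j) := by
    ext t
    have : t ∈ s → (t < hi n j ↔ t < lo n j) := by
      intro ht
      have h3 : t ≠ lo n j := fun h => h1 (h ▸ ht)
      simp only [lo, hi, ne_eq, Fin.ext_iff, Fin.lt_def] at h3 ⊢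
      omega
    have := lo_lt_hi j
    simp only [mem_filter, mem_insert]
    grind
  have hu : insert (hi n j) (insert (lo n j) s) = s ∪ pair n j := by
    ext t; simp only [pair, mem_insert, mem_union, mem_singleton]; tauto
  simp only [Gr.pderiv, h1, if_false, mem_insert, h2, hi_ne_lo, or_self, hc,
    not_false_eq_true, and_self, if_true, hu]
  rw [card_insert_of_notMem (by simp), pow_succ]
  have hs : ((-1 : ℂ) ^ (s.filter fun i => i < lo n j).card) *
      (-1 : ℂ) ^ (s.filter fun i => i < lo n j).card = 1 := by
    rw [← mul_pow]; simp
  linear_combination (-4 * f (s ∪ pair n j)) * hs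

end Pairs

/-- Complementation for functions of fixed degree on a Boolean lattice that are annihilated by
the lowering operator. -/
lemma sum_powerset_eq_of_harmonic {α : Type} [DecidableEq α] (t : ℕ) (h : Finset α → ℂ)
    (E F : Finset α) (hEF : Disjoint E F)
    (hsupp : ∀ T ⊆ E ∪ F, T.card ≠ t → h T = 0)
    (hh : ∀ T ⊆ E ∪ F, ∑ j ∈ (E ∪ F) \ T, h (insert j T) = 0) :
    ∑ T ∈ E.powerset, h T = (-1) ^ t * ∑ T ∈ F.powerset, h T := by
  set M := E ∪ F with hM
  set g : Finset α → ℂ := fun W => ∑ T ∈ M.powerset, if W ⊆ T then h T else 0 with hg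
  have g_eq : ∀ W ⊆ M, t ≤ W.card → g W = h W := by
    intro W hW hc
    rw [hg]
    dsimp only
    rw [Finset.sum_eq_single_of_mem W (mem_powerset.2 hW), if_pos subset_rfl]
    intro T hTM hT
    split_ifs with hWT
    · refine hsupp T (mem_powerset.1 hTM) fun hTt => hT (Finset.eq_of_subset_of_card_le hWT (by omega)).symm
    · rfl
  have g_rec : ∀ W ⊆ M, ∑ j ∈ M \ W, g (insert j W) = ((t : ℂ) - W.card) * g W := by
    intro W hW
    rw [hg]
    dsimp only
    rw [Finset.sum_comm, Finset.mul_sum]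
    refine Finset.sum_congr rfl fun T hT => ?_
    rw [mem_powerset] at hT
    by_cases hWT : W ⊆ T
    · have : ∀ j ∈ M \ W, (if insert j W ⊆ T then h T else 0) = if j ∈ T then h T else 0 := by
        intro j _
        simp [Finset.insert_subset_iff, hWT]
      rw [Finset.sum_congr rfl this, ← Finset.sum_filter, Finset.sum_const, if_pos hWT]
      have hf : (M \ W).filter (· ∈ T) = T \ W := by
        ext x; simp only [mem_filter, mem_sdiff]
        exact ⟨fun h => ⟨h.2, h.1.2⟩, fun h => ⟨⟨hT h.1, h.2⟩, h.1⟩⟩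
      rw [hf, card_sdiff_of_subset hWT, nsmul_eq_mul, Nat.cast_sub (card_le_card hWT)]
      by_cases hTt : T.card = t
      · rw [hTt]
      · simp [hsupp T hT hTt]
    · simp [Finset.insert_subset_iff, hWT]
  have g_zero : ∀ d W, W ⊆ M → W.card + d + 1 = t → g W = 0 := by
    intro d
    induction d with
    | zero =>
      intro W hW hc
      have h1 := g_rec W hW
      rw [Finset.sum_congr rfl fun j hj => g_eq (insert j W) ?_ ?_, hh W hW, ← hc] at h1
      · push_cast at h1
        simpa using h1.symm
      · exact Finset.insert_subset (mem_sdiff.1 hj).1 hW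
      · rw [card_insert_of_notMem (mem_sdiff.1 hj).2]; omega
    | succ d ih =>
      intro W hW hc
      have h1 := g_rec W hW
      rw [Finset.sum_eq_zero fun j hj => ih (insert j W) ?_ ?_, ← hc] at h1
      · rcases mul_eq_zero.1 h1.symm with h2 | h2
        · exfalso
          have h3 : ((d + 2 : ℕ) : ℂ) = 0 := by
            push_cast at h2 ⊢
            linear_combination h2
          exact absurd (Nat.cast_eq_zero.1 h3) (by omega)
        · exact h2
      · exact Finset.insert_subset (mem_sdiff.1 hj).1 hW
      · rw [card_insert_of_notMem (mem_sdiff.1 hj).2]; omega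
  have incl_excl : ∑ T ∈ E.powerset, h T = ∑ W ∈ F.powerset, (-1) ^ W.card * g W := by
    rw [hg]
    simp only [Finset.mul_sum]
    rw [Finset.sum_comm]
    have hi : ∀ T ∈ M.powerset, (∑ W ∈ F.powerset, (-1 : ℂ) ^ W.card * if W ⊆ T then h T else 0) =
        if T ⊆ E then h T else 0 := by
      intro T hT
      rw [mem_powerset] at hT
      have h1 : (∑ W ∈ F.powerset, (-1 : ℂ) ^ W.card * if W ⊆ T then h T else 0) =
          (∑ W ∈ (F ∩ T).powerset, (-1 : ℂ) ^ W.card) * h T := by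
        rw [Finset.sum_mul]
        simp only [mul_ite, mul_zero]
        rw [← Finset.sum_filter]
        refine Finset.sum_congr ?_ fun _ _ => rfl
        ext W
        rw [mem_filter, mem_powerset, mem_powerset, Finset.subset_inter_iff]
      have h2 := congrArg (Int.cast : ℤ → ℂ) (Finset.sum_powerset_neg_one_pow_card (x := F ∩ T))
      push_cast at h2
      rw [h1, h2]
      have h3 : F ∩ T = ∅ ↔ T ⊆ E := by
        rw [← Finset.disjoint_iff_inter_eq_empty]
        constructor
        · intro hd x hx
          rcases mem_union.1 (hT hx) with h | h
          · exact h
          · exact absurd hx (Finset.disjoint_left.1 hd h)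
        · exact fun hTE => (hEF.mono_left hTE).symm
      simp [h3]
    rw [Finset.sum_congr rfl hi, ← Finset.sum_filter]
    refine Finset.sum_congr ?_ fun _ _ => rfl
    ext T
    simp only [mem_filter, mem_powerset]
    exact ⟨fun h => ⟨h.trans subset_union_left, h⟩, fun h => h.2⟩
  rw [incl_excl, Finset.mul_sum]
  refine Finset.sum_congr rfl fun W hW => ?_
  have hWM : W ⊆ M := (mem_powerset.1 hW).trans subset_union_right
  rcases lt_trichotomy W.card t with hc | hc | hc
  · rw [g_zero (t - W.card - 1) W hWM (by omega), hsupp W hWM (by omega)]; simp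
  · rw [g_eq W hWM hc.ge, hc]
  · rw [g_eq W hWM hc.le, hsupp W hWM (by omega)]; simp

section Kernel

variable {n : ℕ}

lemma Gr.derivList_apply {N : ℕ} (l : List (Fin N)) (hl : l.Pairwise (· < ·))
    (F : Gr ℂ N) (s : Finset (Fin N)) (hs : ∀ a ∈ l, ∀ b ∈ s, a < b) :
    Gr.derivList l F s = F (l.toFinset ∪ s) := by
  induction l generalizing F with
  | nil => simp [Gr.derivList]
  | cons a l ih =>
    rw [List.pairwise_cons] at hl
    have h1 : ∀ b ∈ l.toFinset ∪ s, a < b := by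
      intro b hb
      rcases mem_union.1 hb with h | h
      · exact hl.1 b (List.mem_toFinset.1 h)
      · exact hs a List.mem_cons_self b h
    have h2 : a ∉ l.toFinset ∪ s := fun h => lt_irrefl a (h1 a h)
    have h3 : (l.toFinset ∪ s).filter (· < a) = ∅ :=
      filter_eq_empty_iff.2 fun b hb => (h1 b hb).not_gt
    change Gr.derivList l (Gr.pderiv a F) s = _
    rw [ih hl.2 _ fun b hb => hs b (List.mem_cons_of_mem _ hb), Gr.pderiv, if_neg h2, h3,
      card_empty, pow_zero, one_mul, List.toFinset_cons, insert_union]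

@[simp] lemma xi_inj {a b : Fin (2 * n)} : xi n a = xi n b ↔ a = b := by
  simp [xi, Fin.ext_iff]

@[simp] lemma yi_inj {a b : Fin (2 * n)} : yi n a = yi n b ↔ a = b := by
  simp [yi, Fin.ext_iff]

@[simp] lemma xi_lt_xi {a b : Fin (2 * n)} : xi n a < xi n b ↔ a < b := Iff.rfl

@[simp] lemma yi_lt_yi {a b : Fin (2 * n)} : yi n a < yi n b ↔ a < b := by
  simp only [yi, Fin.lt_def, Fin.val_natAdd, Nat.add_lt_add_iff_left]

@[simp] lemma xi_lt_yi (a b : Fin (2 * n)) : xi n a < yi n b := by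
  simp only [xi, yi, Fin.lt_def, Fin.val_castAdd, Fin.val_natAdd]
  omega

@[simp] lemma not_yi_lt_xi (a b : Fin (2 * n)) : ¬ yi n a < xi n b :=
  (xi_lt_yi b a).not_gt

@[simp] lemma xi_ne_yi (a b : Fin (2 * n)) : xi n a ≠ yi n b := (xi_lt_yi a b).ne

@[simp] lemma yi_ne_xi (a b : Fin (2 * n)) : yi n a ≠ xi n b := (xi_lt_yi b a).ne'

lemma exists_eq_xi_or_eq_yi (t : Fin (2 * n + 2 * n)) : ∃ a, t = xi n a ∨ t = yi n a := by
  rcases Fin.addCases (motive := fun t => ∃ a, t = xi n a ∨ t = yi n a)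
    (fun a => ⟨a, Or.inl rfl⟩) (fun a => ⟨a, Or.inr rfl⟩) t with ⟨a, h⟩
  exact ⟨a, h⟩

lemma xy_ext {s t : Finset (Fin (2 * n + 2 * n))}
    (h : ∀ a, (xi n a ∈ s ↔ xi n a ∈ t) ∧ (yi n a ∈ s ↔ yi n a ∈ t)) : s = t := by
  ext x
  obtain ⟨a, rfl | rfl⟩ := exists_eq_xi_or_eq_yi x
  exacts [(h a).1, (h a).2]

lemma embX_image_union (f : Gr ℂ (2 * n)) (B D : Finset (Fin (2 * n))) :
    embX n f (B.image (xi n) ∪ D.image (yi n)) = if D = ∅ then f B else 0 := by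
  have h : ∀ A : Finset (Fin (2 * n)),
      B.image (xi n) ∪ D.image (yi n) = A.image (xi n) ↔ D = ∅ ∧ A = B := by
    intro A
    constructor
    · intro h
      constructor
      · rw [eq_empty_iff_forall_notMem]
        intro a ha
        have : yi n a ∈ A.image (xi n) := h ▸ by simp [ha]
        simp at this
      · ext a
        have := congrArg (xi n a ∈ ·) h
        simpa using this.symm
    · rintro ⟨rfl, rfl⟩
      simp
  simp only [embX, h]
  by_cases hD : D = ∅ <;> simp [hD]

/-- The monomial of the Fourier kernel containing the `a`-th `x` generator. -/
def kset (n : ℕ) (a : Fin (2 * n)) : Finset (Fin (2 * n + 2 * n)) := {xi n a, yi n (swp n a)}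

lemma biUnion_kset (C : Finset (Fin (2 * n))) :
    C.biUnion (kset n) = C.image (xi n) ∪ (C.image (swp n)).image (yi n) := by
  apply xy_ext
  intro a
  simp [kset]
  grind

/-- The sign of the reordering of a product of kernel monomials. -/
noncomputable def ksign (n : ℕ) (C : Finset (Fin (2 * n))) : ℂ :=
  ∏ d ∈ C, ∏ a ∈ C, if a < d ∧ d ≠ swp n a then -1 else 1

@[simp] lemma lo_lt_lo {i j : Fin n} : lo n i < lo n j ↔ i < j := by
  simp only [lo, Fin.lt_def]; omega

@[simp] lemma hi_lt_hi {i j : Fin n} : hi n i < hi n j ↔ i < j := by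
  simp only [hi, Fin.lt_def]; omega

@[simp] lemma lo_lt_hi_iff {i j : Fin n} : lo n i < hi n j ↔ i ≤ j := by
  simp only [lo, hi, Fin.lt_def, Fin.le_def]; omega

@[simp] lemma hi_lt_lo_iff {i j : Fin n} : hi n i < lo n j ↔ i < j := by
  simp only [lo, hi, Fin.lt_def]; omega

lemma ksign_insert (D : Finset (Fin (2 * n))) (a : Fin (2 * n)) (ha : a ∉ D) :
    ksign n (insert a D) = ksign n D * Gr.msign (D.biUnion (kset n)) (kset n a) := by
  have hk : ∀ d ∈ D, ∏ x ∈ kset n d, ∏ b ∈ kset n a, (if b < x then (-1 : ℂ) else 1) =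
      (if d < a ∧ a ≠ swp n d then (-1 : ℂ) else 1) *
        if a < d ∧ d ≠ swp n a then (-1 : ℂ) else 1 := by
    intro d hd
    have hne : d ≠ a := fun h => ha (h ▸ hd)
    rw [kset, kset, prod_pair (xi_ne_yi _ _), prod_pair (xi_ne_yi _ _),
      prod_pair (xi_ne_yi _ _)]
    obtain ⟨i, rfl | rfl⟩ := exists_eq_lo_or_eq_hi a <;>
    obtain ⟨j, rfl | rfl⟩ := exists_eq_lo_or_eq_hi d <;>
    rcases lt_trichotomy i j with h | rfl | h
    all_goals first
      | simp [h.le, h.not_ge, h.not_gt, h.ne, h.ne', h]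
      | simp at hne ⊢
  rw [Gr.msign_eq_prod, prod_biUnion, prod_congr rfl hk, prod_mul_distrib, ksign, ksign,
    prod_insert ha, prod_insert ha]
  · simp only [prod_insert ha, prod_mul_distrib, lt_irrefl, false_and, if_false, one_mul]
    ring
  · intro i _ j _ hij
    simp only [Function.onFun, kset]
    simp [hij.symm, swp_injective.eq_iff]

/-- The coefficient of the `a`-th monomial in the exponent of the Fourier kernel. -/
noncomputable def kcoef (n : ℕ) (σ : ℂ) (a : Fin (2 * n)) : ℂ := -σ * (Complex.I / 2) * (-1) ^ (a : ℕ)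

lemma fermK_eq (σ : ℂ) :
    fermK n σ = ∑ C : Finset (Fin (2 * n)),
      (ksign n C * ∏ a ∈ C, kcoef n σ a) • Gr.mono (C.biUnion (kset n)) := by
  have hgen : ∀ a b : Fin (2 * n), Gr.mul (Gr.gen (xi n a)) (Gr.gen (yi n b)) =
      (Gr.mono {xi n a, yi n b} : Gr ℂ (2 * n + 2 * n)) := by
    intro a b
    change Gr.mul (Gr.mono {xi n a}) (Gr.mono {yi n b}) = _
    rw [Gr.mono_mul_mono, if_pos (by simp), Gr.msign_eq_prod]
    simp
  have hexp : ((-σ * (Complex.I / 2)) • ∑ j : Fin n,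
      (Gr.mul (Gr.gen (xi n (lo n j))) (Gr.gen (yi n (hi n j))) -
        Gr.mul (Gr.gen (xi n (hi n j))) (Gr.gen (yi n (lo n j))))) =
      ∑ a, kcoef n σ a • (Gr.mono (kset n a) : Gr ℂ (2 * n + 2 * n)) := by
    rw [sum_pairs, Finset.smul_sum]
    refine Finset.sum_congr rfl fun j _ => ?_
    have h1 : kcoef n σ (lo n j) = -σ * (Complex.I / 2) := by simp [kcoef, lo, pow_mul]
    have h2 : kcoef n σ (hi n j) = -(-σ * (Complex.I / 2)) := by
      simp [kcoef, hi, pow_succ, pow_mul]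
    rw [h1, h2, hgen, hgen, kset, kset, swp_lo, swp_hi, neg_smul, smul_sub, sub_eq_add_neg]
  rw [fermK, hexp, Gr.gexp]
  have hpow := Gr.pow_sum_mono (kset n) (fun a b hab => by
      simp [kset, hab.symm, swp_injective.eq_iff])
    (fun a => ⟨xi n a, by simp [kset]⟩) (kcoef n σ) (ksign n) (by simp [ksign]) ksign_insert
  simp_rw [hpow]
  have hfac : ∀ k : ℕ, ((k.factorial : ℂ))⁻¹ * (k.factorial : ℂ) = 1 := fun k =>
    inv_mul_cancel₀ (Nat.cast_ne_zero.2 k.factorial_ne_zero)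
  simp_rw [smul_smul _ _ (Finset.sum _ _), hfac, one_smul]
  rw [← Finset.sum_fiberwise_of_maps_to (s := univ) (t := range (2 * n + 2 * n + 1))
    (g := fun C : Finset (Fin (2 * n)) => C.card)]
  · refine Finset.sum_congr rfl fun k _ => Finset.sum_congr ?_ fun _ _ => rfl
    ext C
    simp
  · intro C _
    have := card_le_univ C
    rw [Fintype.card_fin] at this
    rw [mem_range]
    omega

lemma prod_univ_ite_mem {ι M : Type} [Fintype ι] [DecidableEq ι] [CommMonoid M] (A : Finset ι)
    (f : ι → M) : (∏ i, if i ∈ A then f i else 1) = ∏ i ∈ A, f i := by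
  rw [prod_ite_mem, univ_inter]

lemma image_swp_image_swp (s : Finset (Fin (2 * n))) : (s.image (swp n)).image (swp n) = s := by
  ext t
  simp only [mem_image_swp, swp_swp]

lemma berezinX_fermK_mul (σ : ℂ) (g : Gr ℂ (2 * n)) (s : Finset (Fin (2 * n))) :
    berezinX n (Gr.mul (fermK n σ) (embX n g)) (s.image (yi n)) =
      ((Real.pi : ℂ) ^ n)⁻¹ *
        ((ksign n (s.image (swp n)) * ∏ a ∈ s.image (swp n), kcoef n σ a) *
          (Gr.msign ((s.image (swp n)).biUnion (kset n)) ((s.image (swp n))ᶜ.image (xi n)) *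
            g (s.image (swp n))ᶜ)) := by
  have hset : ((List.finRange (2 * n)).map (xi n)).toFinset = univ.image (xi n) := by
    ext t; simp
  rw [berezinX, Pi.smul_apply, smul_eq_mul, Gr.derivList_apply, hset]
  · congr 1
    rw [fermK_eq, Gr.sum_mul_left, Finset.sum_apply]
    simp only [Gr.smul_mul_left, Pi.smul_apply, smul_eq_mul, Gr.mono_mul_apply]
    have hsd : ∀ C : Finset (Fin (2 * n)),
        (univ.image (xi n) ∪ s.image (yi n)) \ C.biUnion (kset n) =
          Cᶜ.image (xi n) ∪ (s \ C.image (swp n)).image (yi n) := by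
      intro C
      rw [biUnion_kset]
      apply xy_ext
      intro a
      simp
    rw [Finset.sum_eq_single (s.image (swp n))]
    · rw [if_pos, hsd, image_swp_image_swp, embX_image_union]
      · simp
      · rw [biUnion_kset, image_swp_image_swp]
        exact union_subset_union (image_subset_image (subset_univ _)) subset_rfl
    · intro C _ hC
      split_ifs with h
      · rw [hsd, embX_image_union, if_neg, mul_zero, mul_zero]
        rw [sdiff_eq_empty_iff_subset]
        intro h1
        refine hC ?_
        have h2 : C.image (swp n) ⊆ s := by
          intro a ha
          have : yi n a ∈ univ.image (xi n) ∪ s.image (yi n) := by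
            apply h
            rw [biUnion_kset]
            exact mem_union_right _ (mem_image_of_mem _ ha)
          simpa using this
        rw [h1.antisymm h2, image_swp_image_swp]
      · simp
    · simp
  · rw [List.pairwise_map]
    simpa using List.pairwise_lt_finRange _
  · intro a ha b hb
    obtain ⟨c, -, rfl⟩ := List.mem_map.1 ha
    obtain ⟨d, -, rfl⟩ := mem_image.1 hb
    exact xi_lt_yi c d

lemma msign_biUnion_kset (C : Finset (Fin (2 * n))) :
    (Gr.msign (C.biUnion (kset n)) (Cᶜ.image (xi n)) : ℂ) =
      (∏ d ∈ C, ∏ b ∈ Cᶜ, if b < d then -1 else 1) * (-1) ^ C.card := by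
  have hdisj : Set.PairwiseDisjoint (C : Set (Fin (2 * n))) (kset n) := by
    intro i _ j _ hij
    simp only [Function.onFun, kset]
    simp [hij.symm, swp_injective.eq_iff]
  have hpar : ((-1 : ℂ) ^ (Cᶜ).card) ^ C.card = (-1) ^ C.card := by
    have h1 : (Cᶜ).card + C.card = 2 * n := by
      rw [card_compl_add_card, Fintype.card_fin]
    rcases Nat.even_or_odd C.card with h | h
    · rw [← pow_mul, (h.mul_left _).neg_one_pow, h.neg_one_pow]
    · have : Odd (Cᶜ).card := by
        rcases h with ⟨m, hm⟩
        exact ⟨n - m - 1, by omega⟩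
      rw [this.neg_one_pow]
  rw [Gr.msign_eq_prod, prod_biUnion hdisj]
  have : ∀ d ∈ C, ∏ x ∈ kset n d, ∏ b ∈ Cᶜ.image (xi n), (if b < x then (-1 : ℂ) else 1) =
      (∏ b ∈ Cᶜ, if b < d then (-1 : ℂ) else 1) * (-1) ^ (Cᶜ).card := by
    intro d _
    rw [kset, prod_pair (xi_ne_yi _ _), prod_image fun _ _ _ _ => xi_inj.1,
      prod_image fun _ _ _ _ => xi_inj.1]
    simp
  rw [prod_congr rfl this, prod_mul_distrib, prod_const, hpar]

lemma prod_if_lt (d : Fin (2 * n)) :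
    (∏ a, if a < d then (-1 : ℂ) else 1) = (-1) ^ (d : ℕ) := by
  rw [Finset.prod_ite]
  simp [filter_gt_eq_Iio]

/-- The contribution of a pair of generators to the matrix coefficient of the Fourier
transform at `s`. -/
noncomputable def pairWeight (σ : ℂ) (s : Finset (Fin (2 * n))) (j : Fin n) : ℂ :=
  if lo n j ∈ s then (if hi n j ∈ s then 1 / 2 else σ * Complex.I)
  else if hi n j ∈ s then σ * Complex.I else 2

lemma kernel_coeff_eq (σ : ℂ) (hσ : σ ^ 2 = 1) (s : Finset (Fin (2 * n))) :
    2 ^ n * ((ksign n (s.image (swp n)) * ∏ a ∈ s.image (swp n), kcoef n σ a) *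
      Gr.msign ((s.image (swp n)).biUnion (kset n)) ((s.image (swp n))ᶜ.image (xi n))) =
      ∏ j, pairWeight σ s j := by
  set C := s.image (swp n) with hC
  have h1 : ksign n C * (∏ d ∈ C, ∏ b ∈ Cᶜ, if b < d then (-1 : ℂ) else 1) =
      ∏ d ∈ C, ((-1) ^ (d : ℕ) * if swp n d < d ∧ swp n d ∈ C then (-1 : ℂ) else 1) := by
    rw [ksign, ← prod_mul_distrib]
    refine prod_congr rfl fun d _ => ?_
    have h2 : (∏ a ∈ C, if a < d ∧ d ≠ swp n a then (-1 : ℂ) else 1) =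
        (∏ a ∈ C, if a < d then (-1 : ℂ) else 1) *
          ∏ a ∈ C, if a = swp n d then (if swp n d < d then (-1 : ℂ) else 1) else 1 := by
      rw [← prod_mul_distrib]
      refine prod_congr rfl fun a _ => ?_
      by_cases h : a = swp n d
      · subst h
        by_cases h3 : swp n d < d <;> simp [h3]
      · have : d ≠ swp n a := fun h' => h (by rw [h', swp_swp])
        simp [h, this]
    rw [h2, prod_ite_eq', ← prod_if_lt d, ← prod_mul_prod_compl C]
    by_cases h3 : swp n d < d <;> by_cases h4 : swp n d ∈ C <;> simp [h3, h4]
  have h5 : (ksign n C * ∏ a ∈ C, kcoef n σ a) *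
      ((∏ d ∈ C, ∏ b ∈ Cᶜ, if b < d then (-1 : ℂ) else 1) * (-1) ^ C.card) =
      ∏ d ∈ C, ((if swp n d < d ∧ swp n d ∈ C then (-1 : ℂ) else 1) * (σ * (Complex.I / 2))) := by
    rw [mul_mul_mul_comm, h1, ← prod_const, ← prod_mul_distrib, ← prod_mul_distrib]
    refine prod_congr rfl fun d _ => ?_
    have : ((-1 : ℂ) ^ (d : ℕ)) * (-1) ^ (d : ℕ) = 1 := by rw [← mul_pow]; simp
    rw [kcoef]
    linear_combination ((if swp n d < d ∧ swp n d ∈ C then (-1 : ℂ) else 1) *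
      (σ * (Complex.I / 2))) * this
  have h6 : (2 : ℂ) ^ n = ∏ _j : Fin n, 2 := by simp
  rw [msign_biUnion_kset, h5, ← prod_univ_ite_mem, prod_pairs, h6, ← prod_mul_distrib]
  refine prod_congr rfl fun j _ => ?_
  simp only [hC, mem_image_swp, swp_lo, swp_hi, pairWeight]
  have hσI : (σ * (Complex.I / 2)) * (σ * (Complex.I / 2)) = -1 / 4 := by
    linear_combination (Complex.I ^ 2 / 4) * hσ + Complex.I_sq / 4
  by_cases ha : lo n j ∈ s <;> by_cases hb : hi n j ∈ s <;> simp [ha, hb]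
  all_goals first | linear_combination (-2) * hσI | ring

/-- The Fourier transform acts on coefficients by complementing the set of full pairs and the
set of empty pairs. -/
lemma fermFT_apply (σ : ℂ) (hσ : σ ^ 2 = 1) (g : Gr ℂ (2 * n)) (s : Finset (Fin (2 * n))) :
    fermFT n σ g s = (∏ j, pairWeight σ s j) * g (s.image (swp n))ᶜ := by
  rw [fermFT, berezinX_fermK_mul, ← kernel_coeff_eq σ hσ]
  have : (Real.pi : ℂ) ^ n ≠ 0 := pow_ne_zero _ (Complex.ofReal_ne_zero.2 Real.pi_ne_zero)
  push_cast
  rw [mul_pow]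
  field_simp

end Kernel

section Decomposition

variable {n : ℕ}

lemma pow_xsq_mul_apply_union (k : ℕ) (f : Gr ℂ (2 * n)) (S : Finset (Fin (2 * n)))
    (A : Finset (Fin n)) (hS : ∀ j, lo n j ∈ S → hi n j ∉ S)
    (hA : ∀ j ∈ A, lo n j ∉ S ∧ hi n j ∉ S) :
    Gr.mul (Gr.pow (xsq n) k) f (S ∪ A.biUnion (pair n)) =
      k.factorial * ∑ C ∈ powersetCard k A, f (S ∪ (A \ C).biUnion (pair n)) := by
  have hsub : ∀ C : Finset (Fin n), C.biUnion (pair n) ⊆ S ∪ A.biUnion (pair n) ↔ C ⊆ A := by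
    intro C
    constructor
    · intro h j hj
      have h1 := h (lo_mem_biUnion_pair.2 hj)
      have h2 := h (hi_mem_biUnion_pair.2 hj)
      rw [mem_union, lo_mem_biUnion_pair] at h1
      rw [mem_union, hi_mem_biUnion_pair] at h2
      have := hS j
      tauto
    · exact fun h => (biUnion_subset_biUnion_of_subset_left _ h).trans subset_union_right
  rw [pow_xsq_mul_apply]
  simp only [hsub]
  rw [← Finset.sum_filter]
  congr 1
  refine Finset.sum_congr ?_ fun C hC => ?_
  · ext C
    simp only [mem_filter, mem_powersetCard, subset_univ, true_and]
    tauto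
  · rw [mem_powersetCard] at hC
    congr 1
    apply pairs_ext
    intro j
    have := hA j
    have := @hC.1 j
    simp only [mem_sdiff, mem_union, lo_mem_biUnion_pair, hi_mem_biUnion_pair]
    tauto

lemma card_union_biUnion_pair (S : Finset (Fin (2 * n))) (A : Finset (Fin n))
    (hA : ∀ j ∈ A, lo n j ∉ S ∧ hi n j ∉ S) :
    (S ∪ A.biUnion (pair n)).card = S.card + 2 * A.card := by
  rw [card_union_of_disjoint, card_biUnion fun i _ j _ h => pair_disjoint h]
  · simp [pair, mul_comm]
  · rw [disjoint_biUnion_right]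
    intro j hj
    simp [pair, hA j hj]

/-- The indices `j` for which both generators of the `j`-th pair lie in `s`. -/
def fullPairs (s : Finset (Fin (2 * n))) : Finset (Fin n) :=
  univ.filter fun j => lo n j ∈ s ∧ hi n j ∈ s

/-- The indices `j` for which no generator of the `j`-th pair lies in `s`. -/
def emptyPairs (s : Finset (Fin (2 * n))) : Finset (Fin n) :=
  univ.filter fun j => lo n j ∉ s ∧ hi n j ∉ s

/-- The elements of `s` whose partner does not lie in `s`. -/
def singles (s : Finset (Fin (2 * n))) : Finset (Fin (2 * n)) :=
  s \ (fullPairs s).biUnion (pair n)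

variable (s : Finset (Fin (2 * n)))

@[simp] lemma mem_fullPairs {j : Fin n} : j ∈ fullPairs s ↔ lo n j ∈ s ∧ hi n j ∈ s := by
  simp [fullPairs]

@[simp] lemma mem_emptyPairs {j : Fin n} : j ∈ emptyPairs s ↔ lo n j ∉ s ∧ hi n j ∉ s := by
  simp [emptyPairs]

@[simp] lemma lo_mem_singles {j : Fin n} : lo n j ∈ singles s ↔ lo n j ∈ s ∧ hi n j ∉ s := by
  rw [singles, mem_sdiff, lo_mem_biUnion_pair, mem_fullPairs]
  tauto

@[simp] lemma hi_mem_singles {j : Fin n} : hi n j ∈ singles s ↔ lo n j ∉ s ∧ hi n j ∈ s := by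
  rw [singles, mem_sdiff, hi_mem_biUnion_pair, mem_fullPairs]
  tauto

lemma singles_union_fullPairs : singles s ∪ (fullPairs s).biUnion (pair n) = s := by
  apply pairs_ext
  intro j
  simp only [mem_union, lo_mem_singles, hi_mem_singles, lo_mem_biUnion_pair,
    hi_mem_biUnion_pair, mem_fullPairs]
  tauto

lemma compl_image_swp :
    (s.image (swp n))ᶜ = singles s ∪ (emptyPairs s).biUnion (pair n) := by
  apply pairs_ext
  intro j
  simp only [mem_compl, mem_image_swp, swp_lo, swp_hi, mem_union, lo_mem_singles, hi_mem_singles,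
    lo_mem_biUnion_pair, hi_mem_biUnion_pair, mem_emptyPairs]
  tauto

lemma prod_pairWeight (σ : ℂ) :
    ∏ j, pairWeight σ s j =
      (1 / 2) ^ (fullPairs s).card * 2 ^ (emptyPairs s).card *
        (σ * Complex.I) ^ (singles s).card := by
  rw [← prod_const, ← prod_const, ← prod_const, ← prod_univ_ite_mem (fullPairs s),
    ← prod_univ_ite_mem (emptyPairs s), ← prod_univ_ite_mem (singles s), prod_pairs,
    ← prod_mul_distrib, ← prod_mul_distrib]
  refine prod_congr rfl fun j _ => ?_
  by_cases ha : lo n j ∈ s <;> by_cases hb : hi n j ∈ s <;> simp [pairWeight, ha, hb]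

lemma card_singles_add :
    (singles s).card + (emptyPairs s).card + (fullPairs s).card = n := by
  have h : ∀ (m : ℕ) (A : Finset (Fin m)), A.card = ∑ i, if i ∈ A then 1 else 0 := by
    intro m A; simp
  rw [h _ (singles s), h _ (emptyPairs s), h _ (fullPairs s), sum_pairs, ← sum_add_distrib,
    ← sum_add_distrib]
  trans ∑ _j : Fin n, 1
  · refine sum_congr rfl fun j _ => ?_
    by_cases ha : lo n j ∈ s <;> by_cases hb : hi n j ∈ s <;> simp [ha, hb]
  · simp

end Decomposition

lemma sum_powersetCard_sdiff_of_support {α : Type} [DecidableEq α] (h : Finset α → ℂ)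
    (A : Finset α) (t k : ℕ) (hsupp : ∀ T ⊆ A, T.card ≠ t → h T = 0) :
    ∑ C ∈ powersetCard k A, h (A \ C) =
      if A.card = k + t then ∑ T ∈ A.powerset, h T else 0 := by
  split_ifs with hA
  · have : ∑ T ∈ A.powerset, h T = ∑ T ∈ powersetCard t A, h T := by
      refine (Finset.sum_subset (fun T hT => ?_) fun T hT hT' => ?_).symm
      · exact mem_powerset.2 (mem_powersetCard.1 hT).1
      · rw [mem_powerset] at hT
        exact hsupp T hT fun hc => hT' (mem_powersetCard.2 ⟨hT, hc⟩)
    rw [this]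
    refine Finset.sum_nbij' (A \ ·) (A \ ·) ?_ ?_ ?_ ?_ ?_
    · intro C hC
      rw [mem_powersetCard] at hC ⊢
      exact ⟨sdiff_subset, by rw [card_sdiff_of_subset hC.1]; omega⟩
    · intro C hC
      rw [mem_powersetCard] at hC ⊢
      exact ⟨sdiff_subset, by rw [card_sdiff_of_subset hC.1]; omega⟩
    · exact fun C hC => Finset.sdiff_sdiff_eq_self (mem_powersetCard.1 hC).1
    · exact fun C hC => Finset.sdiff_sdiff_eq_self (mem_powersetCard.1 hC).1
    · exact fun _ _ => rfl
  · refine Finset.sum_eq_zero fun C hC => hsupp _ sdiff_subset ?_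
    rw [mem_powersetCard] at hC
    have := card_le_card hC.1
    rw [card_sdiff_of_subset hC.1]
    omega

/-- Let `H ∈ Λ_{2n}` be a fermionic spherical harmonic of degree `l` and let `k, l`
satisfy `l ≤ n` and `k ≤ n - l`.  Then
`F^±_{0|2n}(x`^{2k} H) = (±i)^l 2^{2k+l-n} (k!/(n-k-l)!) y`^{2n-2k-2l} H(y)`
(sign `σ = ±1`), where `x`^{2k} = (x`²)^k`. -/
theorem fermFT_pow_xsq_mul_harmonic (n k l : ℕ) (hl : l ≤ n) (hk : k ≤ n - l)
    (H : Gr ℂ (2 * n))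
    (hhom : ∀ s : Finset (Fin (2 * n)), s.card ≠ l → H s = 0)
    (hharm : lapF n H = 0) (σ : ℂ) (hσ : σ = 1 ∨ σ = -1) :
    fermFT n σ (Gr.mul (Gr.pow (xsq n) k) H) =
      ((σ * Complex.I) ^ l * (2 : ℂ) ^ (2 * k + l) * (k.factorial : ℂ) /
          ((2 : ℂ) ^ n * ((n - k - l).factorial : ℂ))) •
        Gr.mul (Gr.pow (xsq n) (n - k - l)) H := by
  have hσ2 : σ ^ 2 = 1 := by rcases hσ with rfl | rfl <;> norm_num
  ext s
  rw [Pi.smul_apply, smul_eq_mul, fermFT_apply σ hσ2, compl_image_swp, prod_pairWeight]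
  have hcard := card_singles_add s
  have hcompl := singles_union_fullPairs s
  set S := singles s with hS
  set E := emptyPairs s with hE
  set F := fullPairs s with hF
  have hSS : ∀ j, lo n j ∈ S → hi n j ∉ S := by
    intro j; simp only [hS, lo_mem_singles, hi_mem_singles]; tauto
  have hM : ∀ T ⊆ E ∪ F, ∀ j ∈ T, lo n j ∉ S ∧ hi n j ∉ S := by
    intro T hT j hj
    have := hT hj
    simp only [hS, hE, hF, lo_mem_singles, hi_mem_singles, mem_union, mem_emptyPairs,
      mem_fullPairs] at this ⊢
    tauto
  rw [← hcompl, pow_xsq_mul_apply_union k H S E hSS (hM E subset_union_left),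
    pow_xsq_mul_apply_union (n - k - l) H S F hSS (hM F subset_union_right)]
  set h : Finset (Fin n) → ℂ := fun T => H (S ∪ T.biUnion (pair n)) with hh
  have hzero : ∀ T ⊆ E ∪ F, S.card + 2 * T.card ≠ l → h T = 0 := by
    intro T hT hc
    exact hhom _ (by rwa [card_union_biUnion_pair S T (hM T hT)])
  change _ * (_ * ∑ C ∈ powersetCard k E, h (E \ C)) =
    _ * (_ * ∑ C ∈ powersetCard (n - k - l) F, h (F \ C))
  by_cases ht : ∃ t, S.card + 2 * t = l
  · obtain ⟨t, ht⟩ := ht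
    have hsupp : ∀ T ⊆ E ∪ F, T.card ≠ t → h T = 0 :=
      fun T hT hc => hzero T hT (by omega)
    rw [sum_powersetCard_sdiff_of_support h E t k fun T hT =>
        hsupp T (hT.trans subset_union_left),
      sum_powersetCard_sdiff_of_support h F t (n - k - l) fun T hT =>
        hsupp T (hT.trans subset_union_right)]
    by_cases hEc : E.card = k + t
    · have hFc : F.card = n - k - l + t := by omega
      have hdisj : Disjoint E F := by
        rw [Finset.disjoint_left]
        simp only [hE, hF, mem_emptyPairs, mem_fullPairs]
        tauto
      rw [if_pos hEc, if_pos hFc, sum_powerset_eq_of_harmonic t h E F hdisj hsupp]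
      · obtain ⟨r, hr⟩ : ∃ r, r = n - k - l := ⟨_, rfl⟩
        have hn : n = r + k + l := by omega
        rw [hEc, hFc, ← hr, ← ht]
        have h1 : (σ * Complex.I) ^ (S.card + 2 * t) = (σ * Complex.I) ^ S.card * (-1) ^ t := by
          rw [pow_add, pow_mul, mul_pow σ Complex.I 2, hσ2, Complex.I_sq, one_mul]
        have h2 : (r.factorial : ℂ) ≠ 0 := Nat.cast_ne_zero.2 r.factorial_ne_zero
        have h3 : (2 : ℂ) ^ n = 2 ^ r * 2 ^ k * 2 ^ (S.card + 2 * t) := by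
          rw [← pow_add, ← pow_add, ht, hn]
        rw [h1, h3, one_div, inv_pow]
        generalize ∑ T ∈ F.powerset, h T = X
        generalize (σ * Complex.I) ^ S.card = y
        generalize (-1 : ℂ) ^ t = e
        have h4 : ∀ m : ℕ, (2 : ℂ) ^ m ≠ 0 := fun m => pow_ne_zero m two_ne_zero
        simp only [pow_add, two_mul]
        have hp := h4 S.card
        have hk := h4 k
        have ht := h4 t
        have hr := h4 r
        generalize (2 : ℂ) ^ S.card = p at *
        generalize (2 : ℂ) ^ k = a at *
        generalize (2 : ℂ) ^ t = b at *
        generalize (2 : ℂ) ^ r = c at *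
        field_simp
      · intro T hT
        have h0 := congrFun hharm (S ∪ T.biUnion (pair n))
        rw [lapF_apply, ← Finset.sum_filter, Pi.zero_apply] at h0
        rw [mul_eq_zero, or_iff_right (by norm_num)] at h0
        rw [← h0]
        refine Finset.sum_congr ?_ fun j _ => ?_
        · ext j
          have := hM T hT j
          simp only [hS, hE, hF, mem_sdiff, mem_union, mem_filter, mem_univ, true_and,
            lo_mem_biUnion_pair, hi_mem_biUnion_pair, lo_mem_singles, hi_mem_singles,
            mem_emptyPairs, mem_fullPairs]
          tauto
        · rw [hh]
          dsimp only
          rw [biUnion_insert, union_assoc, union_comm (pair n j)]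
    · rw [if_neg hEc, if_neg (by omega)]
      simp
  · push Not at ht
    rw [Finset.sum_eq_zero, Finset.sum_eq_zero]
    · simp
    · exact fun C _ => hzero _ (sdiff_subset.trans subset_union_right) (ht _)
    · exact fun C _ => hzero _ (sdiff_subset.trans subset_union_left) (ht _)
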